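/- Let A be a finite nilpotent group and let B be a subgroup of A. Then B is a retract of a finite subdirect power of A: there exist a positive integer n, a subgroup D of the direct power A^n such that every coordinate projection D → A is surjective, a surjective group homomorphism μ : D → B, and a group homomorphism ν : B → D with μ ∘ ν = id_B. -/

import Mathlib

open scoped commutatorElement

/-- A decreasing sequence of subgroups `N 0 ≥ N 1 ≥ ⋯` with `⁅N i, N j⁆ ≤ N (i + j)`. -/
structure CommutatorFiltration (G : Type*) [Group G] where
  /-- The terms of the filtration. -/
  term : ℕ → Subgroup G
  antitone_term : Antitone term
  commutator_mem : ∀ {i j : ℕ} {x y : G}, x ∈ term i → y ∈ term j → ⁅x, y⁆ ∈ term (i + j)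

namespace CommutatorFiltration

variable {G : Type*} [Group G] (F : CommutatorFiltration G)

lemma conj_mem {i j : ℕ} {x y : G} (hx : x ∈ F.term i) (hy : y ∈ F.term j) :
    x * y * x⁻¹ ∈ F.term j := by
  have h := mul_mem (F.antitone_term (Nat.le_add_left j i) (F.commutator_mem hx hy)) hy
  simpa [commutatorElement_def] using h

lemma conj_mem' {i j : ℕ} {x y : G} (hx : x ∈ F.term i) (hy : y ∈ F.term j) :
    x⁻¹ * y * x ∈ F.term j := by
  simpa using F.conj_mem (inv_mem hx) hy

/-- Commutators are well defined modulo the next term of the filtration. -/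
lemma commutator_inv_mul_commutator_mem {i j : ℕ} {x x' y y' : G}
    (hx : x ∈ F.term i) (hx' : x⁻¹ * x' ∈ F.term (i + 1))
    (hy : y ∈ F.term j) (hy' : y⁻¹ * y' ∈ F.term (j + 1)) :
    ⁅x, y⁆⁻¹ * ⁅x', y'⁆ ∈ F.term (i + j + 1) := by
  have hy'j : y' ∈ F.term j := by
    simpa using mul_mem hy (F.antitone_term (Nat.le_succ j) hy')
  have h₁ : x * ⁅x⁻¹ * x', y'⁆ * x⁻¹ ∈ F.term (i + j + 1) :=
    F.conj_mem hx (by convert F.commutator_mem hx' hy'j using 2; omega)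
  have h₂ : y * ⁅x, y⁻¹ * y'⁆ * y⁻¹ ∈ F.term (i + j + 1) :=
    F.conj_mem hy (by simpa only [add_assoc] using F.commutator_mem hx hy')
  have h₃ := mul_mem (F.conj_mem' (F.commutator_mem hx hy) h₁) h₂
  convert h₃ using 1
  simp only [commutatorElement_def]
  group

/-- The refinement of a filtration by an endomorphism `τ`: the elements `x` of `F.term m` that
`τ` fixes modulo `F.term (m + 1)`. -/
def refine (τ : G →* G) : CommutatorFiltration G where
  term m :=
    { carrier := {x | x ∈ F.term m ∧ x⁻¹ * τ x ∈ F.term (m + 1)}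
      one_mem' := by simp [one_mem]
      mul_mem' := by
        rintro x y ⟨hx, hx'⟩ ⟨hy, hy'⟩
        refine ⟨mul_mem hx hy, ?_⟩
        convert mul_mem (F.conj_mem' hy hx') hy' using 1
        simp [mul_assoc]
      inv_mem' := by
        rintro x ⟨hx, hx'⟩
        refine ⟨inv_mem hx, ?_⟩
        convert F.conj_mem hx (inv_mem hx') using 1
        simp [mul_assoc] }
  antitone_term _ _ h _ hx :=
    ⟨F.antitone_term h hx.1, F.antitone_term (Nat.add_le_add_right h 1) hx.2⟩
  commutator_mem := by
    rintro i j x y ⟨hx, hx'⟩ ⟨hy, hy'⟩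
    refine ⟨F.commutator_mem hx hy, ?_⟩
    rw [map_commutatorElement]
    exact F.commutator_inv_mul_commutator_mem hx hx' hy hy'

lemma mem_refine {τ : G →* G} {m : ℕ} {x : G} :
    x ∈ (F.refine τ).term m ↔ x ∈ F.term m ∧ x⁻¹ * τ x ∈ F.term (m + 1) :=
  Iff.rfl

lemma mem_refine_of_fixed {τ : G →* G} {m : ℕ} {x : G} (hx : x ∈ F.term m) (h : τ x = x) :
    x ∈ (F.refine τ).term m :=
  F.mem_refine.2 ⟨hx, by simp [h, one_mem]⟩

variable {ι : Type*} (τ : ι → G →* G)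

/-- The successive refinement of a filtration by a list of endomorphisms. -/
def refineList : List ι → CommutatorFiltration G
  | [] => F
  | i :: l => (refineList l).refine (τ i)

lemma mem_refineList_of_fixed {l : List ι} {m : ℕ} {x : G} (hx : x ∈ F.term m)
    (h : ∀ i ∈ l, τ i x = x) : x ∈ (F.refineList τ l).term m := by
  induction l with
  | nil => exact hx
  | cons i l ih =>
    exact mem_refine_of_fixed _ (ih fun j hj => h j (List.mem_cons_of_mem _ hj))
      (h i List.mem_cons_self)

lemma mem_refineList_of_fixed_of_ne {l : List ι} (hl : l.Nodup) {m : ℕ} {x : G} (i : ι)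
    (hx : x ∈ F.term m) (hx' : x⁻¹ * τ i x ∈ F.term (m + 1))
    (h : ∀ j ≠ i, τ j x = x) (h' : ∀ j ≠ i, τ j (x⁻¹ * τ i x) = x⁻¹ * τ i x) :
    x ∈ (F.refineList τ l).term m := by
  induction l with
  | nil => exact hx
  | cons k l ih =>
    obtain ⟨hk, hl⟩ := List.nodup_cons.1 hl
    by_cases hki : k = i
    · subst hki
      have hne : ∀ j ∈ l, j ≠ k := fun j hj hjk => hk (hjk ▸ hj)
      exact (mem_refine _).2 ⟨ih hl, F.mem_refineList_of_fixed τ hx' fun j hj => h' j (hne j hj)⟩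
    · exact mem_refine_of_fixed _ (ih hl) (h k hki)

/-- An element of an iterated refinement killed by all the endomorphisms lies deep in the
original filtration. -/
lemma mem_of_mem_refineList {l : List ι} {m : ℕ} {x : G} (hx : x ∈ (F.refineList τ l).term m)
    (h : ∀ i ∈ l, τ i x = 1) : x ∈ F.term (m + l.length) := by
  induction l generalizing m with
  | nil => exact hx
  | cons i l ih =>
    have h₁ := ((mem_refine _).1 hx).2
    rw [h i List.mem_cons_self, mul_one, inv_mem_iff] at h₁
    convert ih h₁ fun j hj => h j (List.mem_cons_of_mem _ hj) using 2
    simp only [List.length_cons]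
    omega

/-- The pointwise filtration on a power of `G`. -/
def pi (J : Type*) : CommutatorFiltration (J → G) where
  term m := Subgroup.pi Set.univ fun _ => F.term m
  antitone_term _ _ h _ hx j hj := F.antitone_term h (hx j hj)
  commutator_mem hx hy j hj := F.commutator_mem (hx j hj) (hy j hj)

lemma mem_pi {J : Type*} {m : ℕ} {f : J → G} : f ∈ (F.pi J).term m ↔ ∀ j, f j ∈ F.term m := by
  simp [pi, Subgroup.mem_pi]

end CommutatorFiltration

/-- The three subgroups lemma modulo a normal subgroup. -/
lemma commutator_commutator_le_of_rotate {G : Type*} [Group G] {H K L N : Subgroup G} [N.Normal]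
    (h₁ : ⁅⁅K, L⁆, H⁆ ≤ N) (h₂ : ⁅⁅L, H⁆, K⁆ ≤ N) : ⁅⁅H, K⁆, L⁆ ≤ N := by
  have key (S : Subgroup G) : S ≤ N ↔ S.map (QuotientGroup.mk' N) = ⊥ := by
    rw [Subgroup.map_eq_bot_iff, QuotientGroup.ker_mk']
  rw [key, Subgroup.map_commutator, Subgroup.map_commutator] at h₁ h₂ ⊢
  exact Subgroup.commutator_commutator_eq_bot_of_rotate h₁ h₂

lemma commutator_lowerCentralSeries_le (G : Type*) [Group G] (i j : ℕ) :
    ⁅(⊤ : Subgroup G).lowerCentralSeries i, (⊤ : Subgroup G).lowerCentralSeries j⁆ ≤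
      (⊤ : Subgroup G).lowerCentralSeries (i + j + 1) := by
  induction i generalizing j with
  | zero =>
    rw [Subgroup.commutator_comm, zero_add]
    exact le_rfl
  | succ i ih =>
    have h₁ : ⁅⁅(⊤ : Subgroup G), (⊤ : Subgroup G).lowerCentralSeries j⁆,
        (⊤ : Subgroup G).lowerCentralSeries i⁆ ≤
        (⊤ : Subgroup G).lowerCentralSeries (i + 1 + j + 1) := by
      rw [Subgroup.commutator_comm, Subgroup.commutator_comm ⊤]
      exact (ih (j + 1)).trans_eq (by congr 1; omega)
    have h₂ : ⁅⁅(⊤ : Subgroup G).lowerCentralSeries j,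
        (⊤ : Subgroup G).lowerCentralSeries i⁆, (⊤ : Subgroup G)⁆ ≤
        (⊤ : Subgroup G).lowerCentralSeries (i + 1 + j + 1) := by
      rw [Subgroup.commutator_comm ((⊤ : Subgroup G).lowerCentralSeries j)]
      exact (Subgroup.commutator_mono (ih j) le_rfl).trans_eq
        (by rw [show i + 1 + j + 1 = i + j + 1 + 1 by omega]; rfl)
    exact commutator_commutator_le_of_rotate h₁ h₂

/-- The filtration `G, G, ⁅G, G⁆, …`: the lower central series with its first term repeated. -/
def lowerCentralFiltration (G : Type*) [Group G] : CommutatorFiltration G where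
  term m := (⊤ : Subgroup G).lowerCentralSeries (m - 1)
  antitone_term _ _ h := (⊤ : Subgroup G).lowerCentralSeries_antitone (Nat.sub_le_sub_right h 1)
  commutator_mem := by
    intro i j x y hx hy
    rcases i with _ | i
    · rw [zero_add]
      exact Subgroup.commutator_le_right ⊤ _ (Subgroup.commutator_mem_commutator hx hy)
    rcases j with _ | j
    · exact Subgroup.commutator_le_left _ ⊤ (Subgroup.commutator_mem_commutator hx hy)
    · convert commutator_lowerCentralSeries_le G i j (Subgroup.commutator_mem_commutator hx hy)
        using 2
      omega

section Cube

variable {ι : Type*} [DecidableEq ι] (A : Type*) [Group A]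

/-- Pulling a function on the cube `Finset ι` back along `U ↦ insert i U`. -/
def cubePush (i : ι) : (Finset ι → A) →* (Finset ι → A) where
  toFun f U := f (insert i U)
  map_one' := rfl
  map_mul' _ _ := rfl

/-- The function on the cube `Finset ι` equal to `a` on the face of sets containing `i` and to
`1` elsewhere. -/
def cubeFace (i : ι) (a : A) : Finset ι → A := fun U => if i ∈ U then a else 1

variable {A}

/-- The subgroup of functions on the cube `Finset ι` generated by the constants in `B` and the
functions supported and constant on a face `{U | i ∈ U}`. -/
def cubeSubgroup (ι : Type*) [DecidableEq ι] (B : Subgroup A) : Subgroup (Finset ι → A) :=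
  Subgroup.closure
    ({f | ∃ b ∈ B, f = Function.const _ b} ∪ {f | ∃ (i : ι) (a : A), f = cubeFace A i a})

lemma const_mem_cubeSubgroup {B : Subgroup A} {b : A} (hb : b ∈ B) :
    Function.const _ b ∈ cubeSubgroup ι B :=
  Subgroup.subset_closure (Or.inl ⟨b, hb, rfl⟩)

lemma cubeFace_mem_cubeSubgroup (B : Subgroup A) (i : ι) (a : A) :
    cubeFace A i a ∈ cubeSubgroup ι B :=
  Subgroup.subset_closure (Or.inr ⟨i, a, rfl⟩)

lemma apply_empty_mem_of_mem_cubeSubgroup {B : Subgroup A} {f : Finset ι → A}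
    (hf : f ∈ cubeSubgroup ι B) : f ∅ ∈ B := by
  have h : cubeSubgroup ι B ≤ B.comap (Pi.evalMonoidHom (fun _ : Finset ι => A) ∅) := by
    rw [cubeSubgroup, Subgroup.closure_le]
    rintro _ (⟨b, hb, rfl⟩ | ⟨i, a, rfl⟩)
    · exact hb
    · simp [cubeFace, one_mem]
  exact h hf

lemma cubeSubgroup_le_refineList (B : Subgroup A) {l : List ι} (hl : l.Nodup) :
    cubeSubgroup ι B ≤
      (((lowerCentralFiltration A).pi (Finset ι)).refineList (cubePush A) l).term 0 := by
  have htop : ∀ (m : ℕ), m ≤ 1 → ∀ f : Finset ι → A,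
      f ∈ ((lowerCentralFiltration A).pi (Finset ι)).term m := by
    intro m hm f
    rw [CommutatorFiltration.mem_pi]
    intro U
    change f U ∈ (⊤ : Subgroup A).lowerCentralSeries (m - 1)
    simp [Nat.sub_eq_zero_of_le hm]
  rw [cubeSubgroup, Subgroup.closure_le]
  rintro _ (⟨b, -, rfl⟩ | ⟨i, a, rfl⟩)
  · exact CommutatorFiltration.mem_refineList_of_fixed _ _ (htop 0 zero_le_one _) fun _ _ => rfl
  · refine CommutatorFiltration.mem_refineList_of_fixed_of_ne _ _ hl i (htop 0 zero_le_one _)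
      (htop 1 le_rfl _) ?_ ?_
    · intro j hj
      ext U
      simp [cubePush, cubeFace, hj.symm]
    · intro j hj
      ext U
      simp [cubePush, cubeFace, hj.symm]

/-- In a cube whose dimension exceeds the nilpotency class, an element of the cube subgroup is
determined by its values at nonempty sets. -/
lemma eq_one_of_mem_cubeSubgroup [Fintype ι] {B : Subgroup A}
    (hι : (⊤ : Subgroup A).lowerCentralSeries (Fintype.card ι - 1) = ⊥) {f : Finset ι → A}
    (hf : f ∈ cubeSubgroup ι B) (h : ∀ U : Finset ι, U.Nonempty → f U = 1) : f = 1 := by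
  have h₁ := CommutatorFiltration.mem_of_mem_refineList _ _
    (cubeSubgroup_le_refineList B (Finset.nodup_toList (Finset.univ : Finset ι)) hf)
    fun i _ => funext fun U => h _ (Finset.insert_nonempty i U)
  rw [CommutatorFiltration.mem_pi] at h₁
  ext U
  have h₂ : f U ∈ (⊤ : Subgroup A).lowerCentralSeries
      (0 + (Finset.univ : Finset ι).toList.length - 1) := h₁ U
  simpa [hι] using h₂

end Cube

/-- Let `A` be a finite nilpotent group and `B` a subgroup of `A`. Then `B` is a retract of a
finite subdirect power of `A`: there are `n > 0`, a subgroup `D ≤ A^n` with all coordinate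
projections surjective, a surjective homomorphism `μ : D → B`, and a homomorphism `ν : B → D`
with `μ ∘ ν = id`. -/
theorem subgroup_is_retract_of_finite_subdirect_power
    (A : Type*) [Group A] [Finite A] (hA : Group.IsNilpotent A) (B : Subgroup A) :
    ∃ (n : ℕ), 0 < n ∧ ∃ D : Subgroup (Fin n → A),
      (∀ (i : Fin n) (a : A), ∃ d ∈ D, d i = a) ∧
      ∃ (μ : D →* B) (ν : B →* D),
        Function.Surjective μ ∧ ∀ b : B, μ (ν b) = b := by
  obtain ⟨c, hc⟩ := Subgroup.nilpotent_iff_lowerCentralSeries.1 hA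
  let J := {U : Finset (Fin (c + 1)) // U.Nonempty}
  let e : J ≃ Fin (Fintype.card J) := Fintype.equivFin J
  have : Nonempty J := ⟨⟨{0}, Finset.singleton_nonempty 0⟩⟩
  let C := cubeSubgroup (Fin (c + 1)) B
  let ρ : C →* (Fin (Fintype.card J) → A) :=
    { toFun := fun f t => f.1 (e.symm t).1
      map_one' := rfl
      map_mul' := fun _ _ => rfl }
  have hρ : Function.Injective ρ := by
    rw [injective_iff_map_eq_one]
    intro f hf
    refine Subtype.ext (eq_one_of_mem_cubeSubgroup (by simpa using hc) f.2 fun U hU => ?_)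
    simpa [ρ] using congrFun hf (e ⟨U, hU⟩)
  let ev : C →* B :=
    { toFun := fun f => ⟨f.1 ∅, apply_empty_mem_of_mem_cubeSubgroup f.2⟩
      map_one' := rfl
      map_mul' := fun _ _ => rfl }
  let diag : B →* C :=
    { toFun := fun b => ⟨Function.const _ b.1, const_mem_cubeSubgroup b.2⟩
      map_one' := rfl
      map_mul' := fun _ _ => rfl }
  let φ : C ≃* ρ.range := MonoidHom.ofInjective hρ
  have hμν : ∀ b : B, (ev.comp φ.symm.toMonoidHom) ((φ.toMonoidHom.comp diag) b) = b := by
    intro b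
    simp [ev, diag]
    rfl
  refine ⟨Fintype.card J, Fintype.card_pos, ρ.range, fun t a => ?_,
    ev.comp φ.symm.toMonoidHom, φ.toMonoidHom.comp diag, fun b => ⟨_, hμν b⟩, hμν⟩
  obtain ⟨i, hi⟩ := (e.symm t).2
  exact ⟨_, ⟨⟨_, cubeFace_mem_cubeSubgroup B i a⟩, rfl⟩, by simp [ρ, cubeFace, hi]⟩
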